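/- arXiv:2307.04314 — 2 statements merged into one kernel-verified Lean document; each statement's English description precedes it below -/
import Mathlib

section
/- Let n ≥ 2, let μ be the normalized kinematic measure on directed lines meeting S^{n−1} ⊂ ℝⁿ with entry and exit points X(v,z), Y(v,z), and let σ be the uniform probability measure on S^{n−1}. Then for all Borel measurable A, B ⊆ S^{n−1}, μ{(v,z) : X(v,z) ∈ A and Y(v,z) ∈ B} = (∫_{S^{n−1}}∫_{S^{n−1}} ‖x−y‖^{3−n} dσ(x)dσ(y))^{−1} · ∫_A ∫_B ‖x−y‖^{3−n} dσ(x) dσ(y). In other words, the joint distribution of the entry and exit points has density proportional to ‖x−y‖^{3−n} with respect to σ ⊗ σ. -/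
open MeasureTheory Metric Real Filter
open scoped ENNReal RealInnerProductSpace Topology

noncomputable section

/-- Euclidean space `ℝⁿ`. -/
abbrev En (n : ℕ) := EuclideanSpace ℝ (Fin n)

/-- The unit sphere `S^{n-1} ⊂ ℝⁿ`. -/
def unitSphere (n : ℕ) : Set (En n) := Metric.sphere 0 1

/-- The uniform probability (normalized surface) measure on the unit sphere. -/
def sigmaN (n : ℕ) : Measure (En n) :=
  (μH[(n : ℝ) - 1] (unitSphere n))⁻¹ •
    (μH[(n : ℝ) - 1] : Measure (En n)).restrict (unitSphere n)

/-- The open unit disc in the hyperplane orthogonal to `v`. -/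
def disc (n : ℕ) (v : En n) : Set (En n) := {z | ⟪v, z⟫ = 0 ∧ ‖z‖ < 1}

/-- Normalized `(n-1)`-dimensional Hausdorff measure on the disc `{z ∈ v⊥ : ‖z‖ < 1}`. -/
def lambdaN (n : ℕ) (v : En n) : Measure (En n) :=
  (μH[(n : ℝ) - 1] (disc n v))⁻¹ •
    (μH[(n : ℝ) - 1] : Measure (En n)).restrict (disc n v)

/-- The normalized kinematic measure on directed lines meeting the unit sphere,
parametrized by pairs `(v, z)` with `v` the direction and `z ∈ v⊥`, `‖z‖ < 1`. -/
def kinematic (n : ℕ) : Measure (En n × En n) :=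
  (sigmaN n).bind (fun v => (Measure.dirac v).prod (lambdaN n v))

/-- The entry point of the line parametrized by `(v, z)` in the unit sphere. -/
def Xpt (n : ℕ) (p : En n × En n) : En n := p.2 - Real.sqrt (1 - ‖p.2‖ ^ 2) • p.1

/-- The exit point of the line parametrized by `(v, z)` in the unit sphere. -/
def Ypt (n : ℕ) (p : En n × En n) : En n := p.2 + Real.sqrt (1 - ‖p.2‖ ^ 2) • p.1



theorem invariant_measure_ext {G α β : Type*} [Group G] [MeasurableSpace G] [MeasurableMul G]
    [MeasurableInv G] [MeasurableSpace α] [MeasurableSpace β] [MulAction G α]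
    (hact : Measurable (fun p : G × α => p.1 • p.2))
    (η : Measure G) [IsProbabilityMeasure η] [η.IsMulLeftInvariant]
    (ν₁ ν₂ : Measure α) [SFinite ν₁] [SFinite ν₂]
    (h₁ : ∀ g : G, ν₁.map (fun a => g • a) = ν₁) (h₂ : ∀ g : G, ν₂.map (fun a => g • a) = ν₂)
    (T : α → β) (hT : Measurable T) (s : β → α) (hs : Measurable s)
    (o₁ : ∀ᵐ a ∂ν₁, ∃ g : G, a = g • s (T a)) (o₂ : ∀ᵐ a ∂ν₂, ∃ g : G, a = g • s (T a))
    (hTT : ν₁.map T = ν₂.map T) : ν₁ = ν₂ := by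
  ext C hC
  have hact' : Measurable (fun p : G × α => p.1⁻¹ • p.2) :=
    hact.comp ((measurable_fst.inv).prodMk measurable_snd)
  have hg : ∀ g : G, Measurable (fun a : α => g • a) := fun g => hact.comp measurable_prodMk_left
  let Φ : α → ℝ≥0∞ := fun a => η {g | g⁻¹ • a ∈ C}
  have hΦ : Measurable Φ := measurable_measure_prodMk_right (hact' hC)
  have hΦi : ∀ (g : G) (a : α), Φ (g • a) = Φ a := by
    intro g a
    have := measure_preimage_mul η g⁻¹ {g | g⁻¹ • a ∈ C}
    simp only [Φ]
    rw [← this]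
    congr 1
    ext k
    simp [mul_smul]
  have key : ∀ (ν : Measure α) [SFinite ν], (∀ g : G, ν.map (fun a => g • a) = ν) →
      (∀ᵐ a ∂ν, ∃ g : G, a = g • s (T a)) → ν C = ∫⁻ b, Φ (s b) ∂(ν.map T) := by
    intro ν _ hν o
    calc ν C = ∫⁻ g, ν {a | g⁻¹ • a ∈ C} ∂η := by
          have : ∀ g : G, ν {a | g⁻¹ • a ∈ C} = ν C := by
            intro g
            conv_rhs => rw [← hν g⁻¹, Measure.map_apply (hg _) hC]
            rfl
          simp [this]
      _ = (η.prod ν) ((fun p : G × α => p.1⁻¹ • p.2) ⁻¹' C) := by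
          rw [Measure.prod_apply (hact' hC)]; rfl
      _ = ∫⁻ a, Φ a ∂ν := by
          rw [Measure.prod_apply_symm (hact' hC)]; rfl
      _ = ∫⁻ a, Φ (s (T a)) ∂ν := by
          refine lintegral_congr_ae ?_
          filter_upwards [o] with a ha
          obtain ⟨g, hga⟩ := ha
          conv_lhs => rw [hga]
          rw [hΦi]
      _ = _ := by
          exact (lintegral_map (hΦ.comp hs) hT).symm
  rw [key ν₁ h₁ o₁, key ν₂ h₂ o₂, hTT]

/-- The orthogonal group of `ℝⁿ`. -/
abbrev On (n : ℕ) := unitary (En n →L[ℝ] En n)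

instance (n : ℕ) : MeasurableSpace (On n) := borel _
instance (n : ℕ) : BorelSpace (On n) := ⟨rfl⟩

instance (n : ℕ) : ContinuousStar (En n →L[ℝ] En n) :=
  ⟨(ContinuousLinearMap.adjoint (𝕜 := ℝ) (E := En n) (F := En n)).continuous⟩

instance (n : ℕ) : CompactSpace (On n) := by
  apply isCompact_iff_compactSpace.mp
  apply Metric.isCompact_of_isClosed_isBounded isClosed_unitary
  apply (Metric.isBounded_closedBall (x := (0 : En n →L[ℝ] En n)) (r := 1)).subset
  intro u hu
  rw [mem_closedBall_zero_iff]
  refine ContinuousLinearMap.opNorm_le_bound _ zero_le_one fun x => ?_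
  rw [ContinuousLinearMap.norm_map_of_mem_unitary hu, one_mul]

instance (n : ℕ) : SecondCountableTopology (On n) := inferInstance

instance onMulAction (n : ℕ) : MulAction (On n) (En n) := inferInstance
instance onMulAction2 (n : ℕ) : MulAction (On n) (En n × En n) := inferInstance

instance onSMul (n : ℕ) : SMul (On n) (En n) := (onMulAction n).toSMul
instance onSMul2 (n : ℕ) : SMul (On n) (En n × En n) := (onMulAction2 n).toSMul

theorem On_act_meas (n : ℕ) : Measurable (fun p : On n × En n => p.1 • p.2) := by
  apply Continuous.measurable
  change Continuous (fun p : On n × En n => (p.1 : En n →L[ℝ] En n) p.2)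
  fun_prop

theorem On_act_meas2 (n : ℕ) : Measurable (fun p : On n × (En n × En n) => p.1 • p.2) := by
  apply Continuous.measurable
  change Continuous (fun p : On n × (En n × En n) => ((p.1 : En n →L[ℝ] En n) p.2.1,
    (p.1 : En n →L[ℝ] En n) p.2.2))
  fun_prop

theorem On_smul_def (n : ℕ) (g : On n) (x : En n) :
  g • x = Unitary.linearIsometryEquiv g x := rfl

theorem exists_haar (n : ℕ) : ∃ η : Measure (On n), IsProbabilityMeasure η ∧ η.IsMulLeftInvariant := by
  refine ⟨Measure.haarMeasure ⊤, ⟨?_⟩, inferInstance⟩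
  simpa using! Measure.haarMeasure_self (K₀ := (⊤ : TopologicalSpace.PositiveCompacts (On n)))

theorem transitive1 {n : ℕ} (x y : En n) (h : ‖x‖ = ‖y‖) : ∃ g : En n ≃ₗᵢ[ℝ] En n, g x = y :=
  ⟨_, Submodule.reflection_sub h⟩

theorem transitive2 {n : ℕ} (x y x' y' : En n) (hx : ‖x‖ = ‖x'‖) (hy : ‖y‖ = ‖y'‖)
    (h : ⟪x, y⟫ = ⟪x', y'⟫) : ∃ g : En n ≃ₗᵢ[ℝ] En n, g x = x' ∧ g y = y' := by
  obtain ⟨g, rfl⟩ := transitive1 x x' hx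
  have h2 : ‖g y‖ = ‖y'‖ := by simpa using hy
  refine ⟨g.trans (Submodule.reflection (ℝ ∙ (g y - y'))ᗮ), ?_, ?_⟩
  · simp only [LinearIsometryEquiv.trans_apply]
    apply Submodule.reflection_mem_subspace_eq_self
    rw [Submodule.mem_orthogonal_singleton_iff_inner_left, inner_sub_right, ← h]
    simp
  · simpa using! Submodule.reflection_sub h2


/-- The splitting `ℝ × ℝᵐ → ℝ^{m+1}`. -/
def Jm (m : ℕ) (p : ℝ × En m) : En (m + 1) :=
  WithLp.toLp 2 (Fin.cons p.1 p.2.ofLp : Fin (m + 1) → ℝ)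

theorem Jm_inner (m : ℕ) (p q : ℝ × En m) : ⟪Jm m p, Jm m q⟫ = p.1 * q.1 + ⟪p.2, q.2⟫ := by
  simp [Jm, PiLp.inner_apply, Fin.sum_univ_succ, mul_comm]

theorem Jm_norm_sq (m : ℕ) (p : ℝ × En m) : ‖Jm m p‖ ^ 2 = p.1 ^ 2 + ‖p.2‖ ^ 2 := by
  rw [← real_inner_self_eq_norm_sq, Jm_inner, real_inner_self_eq_norm_sq]; ring

theorem Jm_sub (m : ℕ) (p q : ℝ × En m) : Jm m p - Jm m q = Jm m (p - q) := by
  ext i; refine Fin.cases ?_ (fun j => ?_) i <;> simp [Jm]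

theorem Jm_add (m : ℕ) (p q : ℝ × En m) : Jm m p + Jm m q = Jm m (p + q) := by
  ext i; refine Fin.cases ?_ (fun j => ?_) i <;> simp [Jm]

theorem Jm_smul (m : ℕ) (c : ℝ) (p : ℝ × En m) : c • Jm m p = Jm m (c • p) := by
  ext i; refine Fin.cases ?_ (fun j => ?_) i <;> simp [Jm]

theorem Jm_surj (m : ℕ) (x : En (m + 1)) : ∃ p, Jm m p = x := by
  refine ⟨(x 0, WithLp.toLp 2 (fun i => x i.succ)), ?_⟩
  ext i; refine Fin.cases ?_ (fun j => ?_) i <;> simp [Jm]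

theorem Jm_mp (m : ℕ) : MeasurePreserving (Jm m) volume volume := by
  have h1 := (volume_preserving_piFinSuccAbove (fun _ : Fin (m + 1) => ℝ) 0).symm
  have h2 := PiLp.volume_preserving_toLp (Fin (m + 1))
  have h3 : MeasurePreserving (Prod.map (id : ℝ → ℝ) (WithLp.ofLp : En m → (Fin m → ℝ)))
    volume volume := (MeasurePreserving.id _).prod (PiLp.volume_preserving_ofLp (Fin m))
  have := h2.comp (h1.comp h3)
  have hJ : Jm m = WithLp.toLp 2 ∘ (MeasurableEquiv.piFinSuccAbove (fun _ : Fin (m + 1) => ℝ) 0).symm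
      ∘ Prod.map id WithLp.ofLp := by
    funext p
    simp only [Jm, Function.comp, Prod.map]
    congr 1
    simp [MeasurableEquiv.piFinSuccAbove, Fin.insertNthEquiv]
  rw [hJ]
  exact this

theorem Jm_meas (m : ℕ) : Measurable (Jm m) := (Jm_mp m).measurable

theorem Jm_norm0 (m : ℕ) (u : En m) : ‖Jm m (0, u)‖ = ‖u‖ := by
  have := Jm_norm_sq m (0, u)
  simp only [ne_eq, OfNat.ofNat_ne_zero, not_false_eq_true, zero_pow, zero_add] at this
  exact (sq_eq_sq₀ (norm_nonneg _) (norm_nonneg _)).mp this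

theorem Jm_isom (m : ℕ) : Isometry (fun u : En m => Jm m (0, u)) := by
  apply Isometry.of_dist_eq
  intro x y
  rw [dist_eq_norm, dist_eq_norm, Jm_sub, ← Jm_norm0 m (x - y)]
  simp

/-- The base point of the sphere. -/
def e0 (m : ℕ) : En (m + 1) := Jm m (1, 0)

theorem e0_norm (m : ℕ) : ‖e0 m‖ = 1 := by
  have := Jm_norm_sq m (1, 0)
  simp only [one_pow, norm_zero, ne_eq, OfNat.ofNat_ne_zero, not_false_eq_true, zero_pow, add_zero]
    at this
  exact (sq_eq_sq₀ (norm_nonneg _) zero_le_one).mp (by rw [one_pow]; exact this)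

theorem e0_inner (m : ℕ) (p : ℝ × En m) : ⟪e0 m, Jm m p⟫ = p.1 := by
  simp [e0, Jm_inner]

theorem disc_e0 (m : ℕ) : disc (m + 1) (e0 m) = (fun u : En m => Jm m (0, u)) '' ball 0 1 := by
  ext z
  obtain ⟨p, rfl⟩ := Jm_surj m z
  simp only [disc, Set.mem_ofPred_eq, e0_inner, Set.mem_image, mem_ball_zero_iff]
  constructor
  · rintro ⟨h1, h2⟩
    have : p = (0, p.2) := Prod.ext h1 rfl
    rw [this, Jm_norm0] at h2
    exact ⟨p.2, h2, by rw [← this]⟩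
  · rintro ⟨u, hu, h⟩
    rw [← h, Jm_norm0]
    refine ⟨?_, hu⟩
    rw [← e0_inner m p, ← h, e0_inner]

theorem dim_eq (m : ℕ) : ((m + 1 : ℕ) : ℝ) - 1 = (m : ℝ) := by push_cast; ring

instance haarH (m : ℕ) : (μH[(m : ℝ)] : Measure (En m)).IsAddHaarMeasure := by
  simpa using isAddHaarMeasure_hausdorffMeasure (E := En m)

theorem H_image (m : ℕ) (s : Set (En m)) :
    (μH[((m + 1 : ℕ) : ℝ) - 1] : Measure (En (m + 1))) ((fun u : En m => Jm m (0, u)) '' s)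
      = μH[(m : ℝ)] s := by
  rw [dim_eq, (Jm_isom m).hausdorffMeasure_image (Or.inl (Nat.cast_nonneg m))]

theorem H_disc_e0_ne_zero (m : ℕ) :
    (μH[((m + 1 : ℕ) : ℝ) - 1] : Measure (En (m + 1))) (disc (m + 1) (e0 m)) ≠ 0 := by
  rw [disc_e0, H_image]
  exact (measure_ball_pos _ _ one_pos).ne'

theorem H_disc_e0_ne_top (m : ℕ) :
    (μH[((m + 1 : ℕ) : ℝ) - 1] : Measure (En (m + 1))) (disc (m + 1) (e0 m)) ≠ ∞ := by
  rw [disc_e0, H_image]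
  exact measure_ball_lt_top.ne

theorem H_disc_r (m : ℕ) (r : ℝ) (hr0 : 0 ≤ r) (hr : r < 1) :
    (μH[((m + 1 : ℕ) : ℝ) - 1] : Measure (En (m + 1))) ({z | ‖z‖ ≤ r} ∩ disc (m + 1) (e0 m)) =
      ENNReal.ofReal (r ^ m) *
        (μH[((m + 1 : ℕ) : ℝ) - 1] : Measure (En (m + 1))) (disc (m + 1) (e0 m)) := by
  have : {z | ‖z‖ ≤ r} ∩ disc (m + 1) (e0 m) =
      (fun u : En m => Jm m (0, u)) '' closedBall 0 r := by
    rw [disc_e0]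
    ext z
    constructor
    · rintro ⟨h, u, hu, rfl⟩
      refine ⟨u, ?_, rfl⟩
      simpa [Jm_norm0] using h
    · rintro ⟨u, hu, rfl⟩
      rw [mem_closedBall_zero_iff] at hu
      refine ⟨?_, u, ?_, rfl⟩
      · simpa [Jm_norm0] using hu
      · simpa using hu.trans_lt hr
  rw [this, H_image, disc_e0, H_image, Measure.addHaar_closedBall _ _ hr0]
  simp

theorem disc_map {n : ℕ} (g : En n ≃ₗᵢ[ℝ] En n) (v : En n) : disc n v = g ⁻¹' disc n (g v) := by
  ext z; simp [disc]

theorem measurableSet_disc (n : ℕ) (v : En n) : MeasurableSet (disc n v) := by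
  have h1 : IsClosed {z : En n | ⟪v, z⟫ = 0} := isClosed_eq (by fun_prop) (by fun_prop)
  have h2 : IsOpen {z : En n | ‖z‖ < 1} := isOpen_lt (by fun_prop) (by fun_prop)
  exact h1.measurableSet.inter h2.measurableSet

theorem H_disc_map {n : ℕ} (g : En n ≃ₗᵢ[ℝ] En n) (v : En n) (d : ℝ) :
    (μH[d] : Measure (En n)) (disc n v) = μH[d] (disc n (g v)) := by
  rw [disc_map g]
  exact g.toIsometryEquiv.hausdorffMeasure_preimage d _

theorem lambda_map {n : ℕ} (g : En n ≃ₗᵢ[ℝ] En n) (v : En n) :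
    (lambdaN n v).map g = lambdaN n (g v) := by
  unfold lambdaN
  rw [Measure.map_smul, H_disc_map g v]
  congr 1
  have hg : Measurable g := g.continuous.measurable
  rw [disc_map g, ← Measure.restrict_map hg (measurableSet_disc _ _)]
  congr 1
  exact g.toIsometryEquiv.map_hausdorffMeasure _

instance lambda_e0_prob (m : ℕ) : IsProbabilityMeasure (lambdaN (m + 1) (e0 m)) := by
  constructor
  simp only [lambdaN, Measure.smul_apply, smul_eq_mul, Measure.restrict_apply_univ]
  exact ENNReal.inv_mul_cancel (H_disc_e0_ne_zero m) (H_disc_e0_ne_top m)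

theorem lambda_norm (m : ℕ) (hm : 1 ≤ m) (r : ℝ) : lambdaN (m + 1) (e0 m) {z | ‖z‖ ≤ r} =
    ENNReal.ofReal ((min (max r 0) 1) ^ m) := by
  have hmeas : MeasurableSet {z : En (m + 1) | ‖z‖ ≤ r} :=
    (isClosed_le (by fun_prop) (by fun_prop)).measurableSet
  rcases lt_or_ge r 0 with h | h
  · have : {z : En (m + 1) | ‖z‖ ≤ r} = ∅ := by
      ext z
      simp only [Set.mem_ofPred_eq, Set.mem_empty_iff_false, iff_false, not_le]
      exact h.trans_le (norm_nonneg z)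
    rw [this, max_eq_right h.le]
    simp [show m ≠ 0 by omega]
  · rw [max_eq_left h]
    simp only [lambdaN, Measure.smul_apply, smul_eq_mul, Measure.restrict_apply hmeas]
    rcases lt_or_ge r 1 with h1 | h1
    · rw [H_disc_r m r h h1, min_eq_left h1.le, mul_comm, mul_assoc, ENNReal.mul_inv_cancel
        (H_disc_e0_ne_zero m) (H_disc_e0_ne_top m), mul_one]
    · have : {z : En (m + 1) | ‖z‖ ≤ r} ∩ disc (m + 1) (e0 m) = disc (m + 1) (e0 m) := by
        apply Set.inter_eq_right.mpr
        intro z hz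
        exact hz.2.le.trans h1
      rw [this, min_eq_right h1, ENNReal.inv_mul_cancel
        (H_disc_e0_ne_zero m) (H_disc_e0_ne_top m)]
      simp

theorem H_sphere_ne_zero (m : ℕ) :
    (μH[((m + 1 : ℕ) : ℝ) - 1] : Measure (En (m + 1))) (unitSphere (m + 1)) ≠ 0 := by
  intro h0
  let P : En (m + 1) → En (m + 1) := fun y => y - ⟪e0 m, y⟫ • e0 m
  have hP : LipschitzWith 1 P := by
    apply LipschitzWith.of_dist_le_mul
    intro x y
    obtain ⟨p, rfl⟩ := Jm_surj m x
    obtain ⟨q, rfl⟩ := Jm_surj m y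
    simp only [P, e0_inner]
    rw [dist_eq_norm, dist_eq_norm, NNReal.coe_one, one_mul, e0, Jm_smul, Jm_smul, Jm_sub, Jm_sub,
      Jm_sub, Jm_sub]
    apply (sq_le_sq₀ (norm_nonneg _) (norm_nonneg _)).mp
    rw [Jm_norm_sq, Jm_norm_sq]
    simp only [Prod.fst_sub, Prod.snd_sub, Prod.smul_fst, Prod.smul_snd, smul_zero, sub_zero,
      smul_eq_mul, mul_one, sub_self]
    nlinarith [sq_nonneg (p.1 - q.1)]
  have h1 := hP.hausdorffMeasure_image_le (d := ((m + 1 : ℕ) : ℝ) - 1)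
    (by rw [dim_eq]; positivity) (unitSphere (m + 1))
  rw [h0, mul_zero] at h1
  apply H_disc_e0_ne_zero m
  refine le_antisymm (le_trans (measure_mono ?_) h1) bot_le
  rw [disc_e0]
  rintro _ ⟨u, hu, rfl⟩
  rw [mem_ball_zero_iff] at hu
  have hu2 : ‖u‖ ^ 2 ≤ 1 := by nlinarith [norm_nonneg u]
  refine ⟨Jm m (√(1 - ‖u‖ ^ 2), u), ?_, ?_⟩
  · rw [unitSphere, mem_sphere_zero_iff_norm]
    apply (sq_eq_sq₀ (norm_nonneg _) zero_le_one).mp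
    rw [Jm_norm_sq]
    simp only
    rw [Real.sq_sqrt (by linarith)]; ring
  · simp only [P, e0_inner]
    rw [e0, Jm_smul, Jm_sub]
    simp

theorem normalize_lip {V : Type*} [NormedAddCommGroup V] [NormedSpace ℝ V] (a b : V) (ha : 1 ≤ ‖a‖)
    (hb : 1 ≤ ‖b‖) : ‖(‖a‖⁻¹ • a - ‖b‖⁻¹ • b)‖ ≤ 2 * ‖a - b‖ := by
  have ha0 : 0 < ‖a‖ := by linarith
  have hb0 : 0 < ‖b‖ := by linarith
  have h : ‖a‖⁻¹ • a - ‖b‖⁻¹ • b = ‖a‖⁻¹ • (a - b) + (‖a‖⁻¹ - ‖b‖⁻¹) • b := by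
    rw [smul_sub, sub_smul]; abel
  rw [h]
  refine (norm_add_le _ _).trans ?_
  rw [norm_smul, norm_smul, norm_inv, norm_norm]
  have h1 : ‖a‖⁻¹ ≤ 1 := inv_le_one_of_one_le₀ ha
  have h2 : ‖‖a‖⁻¹ - ‖b‖⁻¹‖ * ‖b‖ = ‖a‖⁻¹ * |‖b‖ - ‖a‖| := by
    have : ‖a‖⁻¹ - ‖b‖⁻¹ = ‖a‖⁻¹ * (‖b‖ - ‖a‖) * ‖b‖⁻¹ := by field_simp
    rw [this, Real.norm_eq_abs, abs_mul, abs_mul, abs_of_pos (inv_pos.mpr ha0),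
      abs_of_pos (inv_pos.mpr hb0)]
    field_simp
  rw [h2]
  have h3 : |‖b‖ - ‖a‖| ≤ ‖a - b‖ := by
    rw [norm_sub_rev]; exact abs_norm_sub_norm_le b a
  have h4 : 0 ≤ ‖a‖⁻¹ := by positivity
  nlinarith [abs_nonneg (‖b‖ - ‖a‖), norm_nonneg (a - b)]

theorem H_cap (m : ℕ) :
    (μH[((m + 1 : ℕ) : ℝ) - 1] : Measure (En (m + 1)))
      ({y | 1 / 2 < ⟪e0 m, y⟫} ∩ unitSphere (m + 1)) < ∞ := by
  let f : En m → En (m + 1) := fun u => ‖Jm m (1, u)‖⁻¹ • Jm m (1, u)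
  have hJ : ∀ u : En m, 1 ≤ ‖Jm m (1, u)‖ := by
    intro u
    apply (sq_le_sq₀ zero_le_one (norm_nonneg _)).mp
    rw [Jm_norm_sq]
    nlinarith [sq_nonneg ‖u‖]
  have hf : LipschitzWith 2 f := by
    apply LipschitzWith.of_dist_le_mul
    intro x y
    rw [dist_eq_norm, dist_eq_norm]
    refine (normalize_lip _ _ (hJ x) (hJ y)).trans ?_
    rw [Jm_sub, ← Jm_norm0 m (x - y)]
    simp
  have h1 := hf.hausdorffMeasure_image_le (d := (m : ℝ)) (by positivity) (closedBall 0 2)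
  rw [dim_eq]
  refine lt_of_le_of_lt (measure_mono ?_) (lt_of_le_of_lt h1 ?_)
  · rintro y ⟨hy1, hy2⟩
    obtain ⟨⟨a, u⟩, rfl⟩ := Jm_surj m y
    simp only [Set.mem_ofPred_eq, e0_inner] at hy1
    rw [unitSphere, mem_sphere_zero_iff_norm] at hy2
    have ha : 0 < a := by linarith
    have hsq := Jm_norm_sq m (a, u)
    rw [hy2] at hsq
    simp only at hsq
    have hu : ‖u‖ ≤ 1 := by nlinarith [norm_nonneg u, sq_nonneg a]
    have hsm : Jm m (1, a⁻¹ • u) = a⁻¹ • Jm m (a, u) := by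
      rw [Jm_smul]; simp [ha.ne']
    refine ⟨a⁻¹ • u, ?_, ?_⟩
    · rw [mem_closedBall_zero_iff, norm_smul, norm_inv, Real.norm_eq_abs, abs_of_pos ha]
      have : a⁻¹ ≤ 2 := by
        rw [inv_le_comm₀ ha two_pos]; linarith
      have h0 : 0 ≤ a⁻¹ := by positivity
      nlinarith [norm_nonneg u]
    · simp only [f]
      rw [hsm, norm_smul, hy2, norm_inv, Real.norm_eq_abs, abs_of_pos ha, smul_smul]
      simp [ha.ne']
  · refine ENNReal.mul_lt_top ?_ measure_closedBall_lt_top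
    exact ENNReal.rpow_lt_top_of_nonneg (by positivity) (by simp)

theorem H_sphere_ne_top (m : ℕ) :
    (μH[((m + 1 : ℕ) : ℝ) - 1] : Measure (En (m + 1))) (unitSphere (m + 1)) ≠ ∞ := by
  refine (IsCompact.measure_lt_top_of_nhdsWithin (isCompact_sphere _ _) ?_).ne
  intro x hx
  rw [mem_sphere_zero_iff_norm] at hx
  obtain ⟨g, hg⟩ := transitive1 x (e0 m) (by rw [hx, e0_norm])
  refine ⟨g ⁻¹' ({y | 1 / 2 < ⟪e0 m, y⟫} ∩ unitSphere (m + 1)), ?_, ?_⟩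
  · rw [Set.preimage_inter]
    refine Filter.inter_mem (mem_nhdsWithin_of_mem_nhds ?_) ?_
    · refine IsOpen.mem_nhds ?_ ?_
      · exact (isOpen_lt (by fun_prop) (by fun_prop) : IsOpen {y | 1 / 2 < ⟪e0 m, y⟫}).preimage
          g.continuous
      · simp only [Set.mem_preimage, Set.mem_ofPred_eq, hg, real_inner_self_eq_norm_sq, e0_norm]
        norm_num
    · filter_upwards [self_mem_nhdsWithin] with y hy
      rw [mem_sphere_zero_iff_norm] at hy
      simp [unitSphere, hy]
  · refine lt_of_eq_of_lt ?_ (H_cap m)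
    exact g.toIsometryEquiv.hausdorffMeasure_preimage _ _

instance sigma_prob (m : ℕ) : IsProbabilityMeasure (sigmaN (m + 1)) := by
  constructor
  simp only [sigmaN, Measure.smul_apply, smul_eq_mul, Measure.restrict_apply_univ]
  exact ENNReal.inv_mul_cancel (H_sphere_ne_zero m) (H_sphere_ne_top m)

theorem sigma_ae (m : ℕ) : ∀ᵐ x ∂(sigmaN (m + 1)), ‖x‖ = 1 := by
  unfold sigmaN
  apply Measure.ae_smul_measure
  filter_upwards [ae_restrict_mem (isClosed_sphere.measurableSet)] with x hx
  simpa [unitSphere] using hx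

theorem sigma_map {n : ℕ} (g : En n ≃ₗᵢ[ℝ] En n) : (sigmaN n).map g = sigmaN n := by
  unfold sigmaN
  rw [Measure.map_smul]
  congr 1
  have hg : Measurable g := g.continuous.measurable
  have hs : unitSphere n = g ⁻¹' unitSphere n := by ext x; simp [unitSphere]
  conv_lhs => rw [hs]
  have hS : MeasurableSet (unitSphere n) := isClosed_sphere.measurableSet
  rw [← Measure.restrict_map hg hS]
  congr 1
  exact g.toIsometryEquiv.map_hausdorffMeasure _


/-- Radial projection of the uniform measure on the ball. -/
def ballLaw (m : ℕ) : Measure (En (m + 1)) :=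
  ((volume (ball (0 : En (m + 1)) 1))⁻¹ • volume.restrict (ball (0 : En (m + 1)) 1)).map
    (fun w => ‖w‖⁻¹ • w)

theorem nrm_meas (m : ℕ) : Measurable (fun w : En m => ‖w‖⁻¹ • w) := by fun_prop

theorem volball_ne_zero (m : ℕ) : volume (ball (0 : En m) 1) ≠ 0 :=
  (measure_ball_pos _ _ one_pos).ne'

theorem volball_ne_top (m : ℕ) : volume (ball (0 : En m) 1) ≠ ∞ := measure_ball_lt_top.ne

instance ballLaw_prob (m : ℕ) : IsProbabilityMeasure (ballLaw m) := by
  constructor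
  rw [ballLaw, Measure.map_apply (nrm_meas _) MeasurableSet.univ]
  simp only [Set.preimage_univ, Measure.smul_apply, smul_eq_mul, Measure.restrict_apply_univ]
  exact ENNReal.inv_mul_cancel (volball_ne_zero _) (volball_ne_top _)

theorem ballLaw_map {m : ℕ} (g : En (m + 1) ≃ₗᵢ[ℝ] En (m + 1)) :
    (ballLaw m).map g = ballLaw m := by
  have hg : Measurable g := g.continuous.measurable
  unfold ballLaw
  rw [Measure.map_map hg (nrm_meas _), Measure.map_smul, Measure.map_smul]
  congr 1
  have hs : ball (0 : En (m + 1)) 1 = g ⁻¹' ball (0 : En (m + 1)) 1 := by ext x; simp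
  have hc : (g ∘ fun w : En (m + 1) => ‖w‖⁻¹ • w) = (fun w : En (m + 1) => ‖w‖⁻¹ • w) ∘ g := by
    ext1 w; simp
  rw [hc, ← Measure.map_map (nrm_meas _) hg]
  congr 1
  conv_lhs => rw [hs]
  rw [← Measure.restrict_map hg isOpen_ball.measurableSet]
  congr 1
  exact g.measurePreserving.map_eq

theorem ballLaw_ae (m : ℕ) : ∀ᵐ x ∂(ballLaw m), ‖x‖ = 1 := by
  unfold ballLaw
  rw [ae_map_iff (nrm_meas _).aemeasurable (isClosed_eq (by fun_prop) (by fun_prop)).measurableSet]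
  apply Measure.ae_smul_measure
  apply ae_restrict_of_ae
  have : ∀ᵐ w : En (m + 1), w ≠ 0 := by
    have h := Measure.ae_ne volume (0 : En (m + 1))
    exact h
  filter_upwards [this] with w hw
  rw [norm_smul, norm_inv, norm_norm]
  exact inv_mul_cancel₀ (norm_ne_zero_iff.mpr hw)

theorem sigma_eq (m : ℕ) : sigmaN (m + 1) = ballLaw m := by
  obtain ⟨η, h1, h2⟩ := exists_haar (m + 1)
  have orb : ∀ x : En (m + 1), ‖x‖ = 1 → ∃ g : On (m + 1), x = g • e0 m := by
    intro x hx
    obtain ⟨g, hg⟩ := transitive1 (e0 m) x (by rw [hx, e0_norm])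
    refine ⟨Unitary.linearIsometryEquiv.symm g, ?_⟩
    rw [On_smul_def, MulEquiv.apply_symm_apply, hg]
  refine invariant_measure_ext (On_act_meas (m + 1)) η _ _ (fun g => sigma_map (Unitary.linearIsometryEquiv g))
    (fun g => ballLaw_map (Unitary.linearIsometryEquiv g)) (fun _ => ()) measurable_const (fun _ => e0 m) measurable_const
    ?_ ?_ ?_
  · filter_upwards [sigma_ae m] with x hx using orb x hx
  · filter_upwards [ballLaw_ae m] with x hx using orb x hx
  · rw [Measure.map_const, Measure.map_const]; simp

theorem lintegral_radial (m : ℕ) (hm : 1 ≤ m) : ∃ S : ℝ≥0∞, S ≠ 0 ∧ S ≠ ∞ ∧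
    ∀ f : ℝ → ℝ≥0∞, Measurable f →
      ∫⁻ u : En m, f ‖u‖ = S * ∫⁻ s in Set.Ioi (0 : ℝ), ENNReal.ofReal (s ^ (m - 1)) * f s := by
  have : Nonempty (Fin m) := ⟨⟨0, hm⟩⟩
  have : Nontrivial (En m) := inferInstance
  refine ⟨(volume : Measure (En m)).toSphere Set.univ, ?_, measure_ne_top _ _, ?_⟩
  · intro h
    exact Measure.toSphere_ne_zero (volume : Measure (En m)) (Measure.measure_univ_eq_zero.mp h)
  intro f hf
  calc
    ∫⁻ x : En m, f (‖x‖) = ∫⁻ x : ({(0)}ᶜ : Set (En m)), f (‖x.1‖) ∂((volume : Measure (En m)).comap (↑)) := by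
      rw [lintegral_subtype_comap (measurableSet_singleton _).compl fun x : En m ↦ f (‖x‖),
        restrict_compl_singleton]
    _ = ∫⁻ x, f x.2 ∂(volume : Measure (En m)).toSphere.prod (.volumeIoiPow (Module.finrank ℝ (En m) - 1)) := by
      simpa using (volume : Measure (En m)).measurePreserving_homeomorphUnitSphereProd.lintegral_comp_emb
        (Homeomorph.measurableEmbedding _) (f ∘ Subtype.val ∘ Prod.snd)
    _ = (volume : Measure (En m)).toSphere Set.univ * ∫⁻ x : Set.Ioi (0 : ℝ), f x ∂.volumeIoiPow (Module.finrank ℝ (En m) - 1) := by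
      rw [lintegral_prod _ (by fun_prop)]
      simp [mul_comm]
    _ = _ := by
      rw [Measure.volumeIoiPow, lintegral_withDensity_eq_lintegral_mul _ (by fun_prop) (by fun_prop)]
      congr 1
      rw [← lintegral_subtype_comap measurableSet_Ioi]
      simp

theorem polar_calc (m : ℕ) (hm : 1 ≤ m) (ψ : ℝ → ℝ≥0∞) (hψ : Measurable ψ) :
    ∫⁻ a : ℝ, ∫⁻ s in Set.Ioi (0 : ℝ), ENNReal.ofReal (s ^ (m - 1)) *
        (if a ^ 2 + s ^ 2 < 1 then ψ ((√(a ^ 2 + s ^ 2))⁻¹ * a) else 0)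
      = (∫⁻ ρ in Set.Ioi (0 : ℝ), (if ρ < 1 then ENNReal.ofReal (ρ ^ m) else 0)) *
        ∫⁻ θ in Set.Ioo 0 π, ENNReal.ofReal (sin θ ^ (m - 1)) * ψ (cos θ) := by
  let F : ℝ × ℝ → ℝ≥0∞ := fun p => if 0 < p.2 then ENNReal.ofReal (p.2 ^ (m - 1)) *
        (if p.1 ^ 2 + p.2 ^ 2 < 1 then ψ ((√(p.1 ^ 2 + p.2 ^ 2))⁻¹ * p.1) else 0) else 0
  have hF : Measurable F := by
    refine Measurable.ite (measurableSet_lt measurable_const measurable_snd) ?_ measurable_const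
    refine Measurable.mul (by fun_prop) ?_
    refine Measurable.ite (measurableSet_lt (by fun_prop) measurable_const) ?_ measurable_const
    exact hψ.comp (by fun_prop)
  let R : ℝ → ℝ≥0∞ := fun ρ => if ρ < 1 then ENNReal.ofReal (ρ ^ m) else 0
  have hR : Measurable R := Measurable.ite (measurableSet_lt measurable_id measurable_const)
    (by fun_prop) measurable_const
  let Θ : ℝ → ℝ≥0∞ := fun θ => ENNReal.ofReal (sin θ ^ (m - 1)) * ψ (cos θ)
  have hΘ : Measurable Θ := Measurable.mul (by fun_prop) (hψ.comp (by fun_prop))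
  calc _ = ∫⁻ a : ℝ, ∫⁻ s, F (a, s) := by
        refine lintegral_congr fun a => ?_
        rw [← lintegral_indicator measurableSet_Ioi]
        refine lintegral_congr fun s => ?_
        simp only [Set.indicator, Set.mem_Ioi, F]
    _ = ∫⁻ p, F p := by
        rw [Measure.volume_eq_prod, lintegral_prod _ hF.aemeasurable]
    _ = ∫⁻ p in Set.Ioi (0 : ℝ) ×ˢ Set.Ioo (-π) π, ENNReal.ofReal p.1 • F (polarCoord.symm p) :=
        (lintegral_comp_polarCoord_symm F).symm
    _ = ∫⁻ p in Set.Ioi (0 : ℝ) ×ˢ Set.Ioo (-π) π, R p.1 * (Set.Ioo 0 π).indicator Θ p.2 := by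
        refine setLIntegral_congr_fun (measurableSet_Ioi.prod measurableSet_Ioo) ?_
        rintro ⟨ρ, θ⟩ ⟨h1, h2⟩
        simp only [Set.mem_Ioi, Set.mem_Ioo] at h1 h2
        simp only [polarCoord_symm_apply, F, R, smul_eq_mul]
        have hsum : (ρ * cos θ) ^ 2 + (ρ * sin θ) ^ 2 = ρ ^ 2 := by
          have := sin_sq_add_cos_sq θ
          nlinarith
        rw [hsum, Real.sqrt_sq h1.le]
        by_cases hθ : 0 < θ
        · have hs : 0 < sin θ := sin_pos_of_pos_of_lt_pi hθ h2.2
          rw [if_pos (mul_pos h1 hs), Set.indicator_of_mem (show θ ∈ Set.Ioo 0 π from ⟨hθ, h2.2⟩)]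
          have hiff : ρ ^ 2 < 1 ↔ ρ < 1 := by
            constructor <;> intro h <;> nlinarith
          by_cases hρ : ρ < 1
          · rw [if_pos (hiff.mpr hρ), if_pos hρ, inv_mul_cancel_left₀ h1.ne']
            simp only [Θ]
            rw [← mul_assoc, ← mul_assoc, ← ENNReal.ofReal_mul h1.le,
              ← ENNReal.ofReal_mul (by positivity)]
            congr 2
            obtain ⟨k, rfl⟩ : ∃ k, m = k + 1 := ⟨m - 1, by omega⟩
            simp only [Nat.add_sub_cancel]
            ring
          · rw [if_neg (fun h => hρ (hiff.mp h)), if_neg hρ]; simp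
        · have hs : sin θ ≤ 0 := sin_nonpos_of_nonpos_of_neg_pi_le (not_lt.mp hθ) h2.1.le
          rw [if_neg (not_lt.mpr (mul_nonpos_of_nonneg_of_nonpos h1.le hs)),
            Set.indicator_of_notMem (fun h => hθ h.1)]
          simp
    _ = (∫⁻ ρ in Set.Ioi (0 : ℝ), R ρ) * ∫⁻ θ in Set.Ioo (-π) π, (Set.Ioo 0 π).indicator Θ θ := by
        rw [Measure.volume_eq_prod, ← Measure.prod_restrict,
          lintegral_prod_mul hR.aemeasurable (hΘ.indicator measurableSet_Ioo).aemeasurable]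
    _ = _ := by
        congr 1
        rw [setLIntegral_indicator measurableSet_Ioo]
        congr 2
        apply Set.inter_eq_left.mpr
        exact Set.Ioo_subset_Ioo (by linarith [pi_pos]) le_rfl

theorem marginal (m : ℕ) (hm : 1 ≤ m) : ∃ K : ℝ≥0∞, K ≠ 0 ∧ K ≠ ∞ ∧
    ∀ ψ : ℝ → ℝ≥0∞, Measurable ψ → ∫⁻ y, ψ ⟪e0 m, y⟫ ∂(sigmaN (m + 1)) =
      K * ∫⁻ θ in Set.Ioo 0 π, ENNReal.ofReal (sin θ ^ (m - 1)) * ψ (cos θ) := by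
  obtain ⟨S, hS0, hS1, hS⟩ := lintegral_radial m hm
  have hR : ∫⁻ ρ in Set.Ioi (0 : ℝ), (if ρ < 1 then ENNReal.ofReal (ρ ^ m) else 0)
      = ENNReal.ofReal (1 / (m + 1)) := by
    have h1 : ∫⁻ ρ in Set.Ioi (0 : ℝ), (if ρ < 1 then ENNReal.ofReal (ρ ^ m) else 0)
        = ∫⁻ ρ in Set.Ioi (0 : ℝ), (Set.Iio 1).indicator (fun ρ => ENNReal.ofReal (ρ ^ m)) ρ := rfl
    rw [h1, setLIntegral_indicator measurableSet_Iio, Set.inter_comm, Set.Ioi_inter_Iio,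
      Measure.restrict_congr_set Ioo_ae_eq_Ioc, ← ofReal_integral_eq_lintegral_ofReal,
      ← intervalIntegral.integral_of_le zero_le_one]
    · simp
    · exact (intervalIntegral.intervalIntegrable_pow _).1
    · filter_upwards [ae_restrict_mem measurableSet_Ioc] with y hy
      exact pow_nonneg hy.1.le _
  refine ⟨(volume (ball (0 : En (m + 1)) 1))⁻¹ * (S * ENNReal.ofReal (1 / (m + 1))), ?_, ?_, ?_⟩
  · refine mul_ne_zero (ENNReal.inv_ne_zero.mpr (volball_ne_top _)) (mul_ne_zero hS0 ?_)
    rw [Ne, ENNReal.ofReal_eq_zero, not_le]; positivity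
  · exact ENNReal.mul_ne_top (ENNReal.inv_ne_top.mpr (volball_ne_zero _))
      (ENNReal.mul_ne_top hS1 ENNReal.ofReal_ne_top)
  intro ψ hψ
  let q : ℝ × ℝ → ℝ≥0∞ := fun p =>
    (if p.1 ^ 2 + p.2 ^ 2 < 1 then ψ ((√(p.1 ^ 2 + p.2 ^ 2))⁻¹ * p.1) else 0)
  have hq : Measurable q := by
    refine Measurable.ite (measurableSet_lt (by fun_prop) measurable_const) ?_ measurable_const
    exact hψ.comp (by fun_prop)
  have hψe : Measurable (fun y : En (m + 1) => ψ ⟪e0 m, y⟫) := hψ.comp (by fun_prop)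
  rw [sigma_eq, ballLaw, lintegral_map hψe (nrm_meas _), lintegral_smul_measure, smul_eq_mul,
    mul_assoc]
  congr 1
  calc ∫⁻ w in ball (0 : En (m + 1)) 1, ψ ⟪e0 m, ‖w‖⁻¹ • w⟫
      = ∫⁻ w : En (m + 1), (ball (0 : En (m + 1)) 1).indicator (fun w => ψ ⟪e0 m, ‖w‖⁻¹ • w⟫) w :=
        (lintegral_indicator isOpen_ball.measurableSet _).symm
    _ = ∫⁻ p : ℝ × En m, (ball (0 : En (m + 1)) 1).indicator
          (fun w => ψ ⟪e0 m, ‖w‖⁻¹ • w⟫) (Jm m p) := by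
        refine ((Jm_mp m).lintegral_comp ?_).symm
        exact (hψe.comp (nrm_meas _)).indicator isOpen_ball.measurableSet
    _ = ∫⁻ p : ℝ × En m, q (p.1, ‖p.2‖) := by
        refine lintegral_congr fun p => ?_
        have h1 : ‖Jm m p‖ = √(p.1 ^ 2 + ‖p.2‖ ^ 2) := by
          rw [← Jm_norm_sq, Real.sqrt_sq (norm_nonneg _)]
        have h2 : ‖Jm m p‖ < 1 ↔ p.1 ^ 2 + ‖p.2‖ ^ 2 < 1 := by
          rw [← Jm_norm_sq]
          constructor <;> intro h <;> nlinarith [norm_nonneg (Jm m p)]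
        simp only [Set.indicator, mem_ball_zero_iff, q, h2, inner_smul_right, e0_inner]
        simp only [h1]
    _ = ∫⁻ a : ℝ, ∫⁻ u : En m, q (a, ‖u‖) := by
        rw [Measure.volume_eq_prod, lintegral_prod]
        exact (hq.comp (by fun_prop)).aemeasurable
    _ = ∫⁻ a : ℝ, S * ∫⁻ s in Set.Ioi (0 : ℝ), ENNReal.ofReal (s ^ (m - 1)) * q (a, s) := by
        refine lintegral_congr fun a => ?_
        exact hS (fun s => q (a, s)) (hq.comp (by fun_prop))
    _ = S * ∫⁻ a : ℝ, ∫⁻ s in Set.Ioi (0 : ℝ), ENNReal.ofReal (s ^ (m - 1)) * q (a, s) := by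
        rw [lintegral_const_mul' _ _ hS1]
    _ = _ := by
        rw [polar_calc m hm ψ hψ, hR, mul_assoc]


theorem trig_int (m : ℕ) (hm : 1 ≤ m) (α : ℝ) (hα0 : 0 ≤ α) (hα1 : α ≤ π / 2) :
    ∫⁻ θ in Set.Ioo (2 * α) π, ENNReal.ofReal (2 * sin (θ / 2) * cos (θ / 2) ^ (m - 1)) =
      ENNReal.ofReal (4 / m * cos α ^ m) := by
  have hle : 2 * α ≤ π := by linarith
  rw [Measure.restrict_congr_set Ioo_ae_eq_Ioc, ← ofReal_integral_eq_lintegral_ofReal,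
    ← intervalIntegral.integral_of_le hle]
  · congr 1
    have hd : ∀ θ ∈ Set.uIcc (2 * α) π, HasDerivAt (fun θ => -(4 / m * cos (θ / 2) ^ m))
        (2 * sin (θ / 2) * cos (θ / 2) ^ (m - 1)) θ := by
      intro θ _
      have h1 : HasDerivAt (fun θ : ℝ => θ / 2) (1 / 2) θ := (hasDerivAt_id θ).div_const 2
      have h2 := (((h1.cos).pow m).const_mul (4 / (m : ℝ))).neg
      have hm0 : (m : ℝ) ≠ 0 := by positivity
      have h3 : -(4 / (m : ℝ) * (m * cos (θ / 2) ^ (m - 1) * (-sin (θ / 2) * (1 / 2)))) =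
          2 * sin (θ / 2) * cos (θ / 2) ^ (m - 1) := by
        field_simp
        ring
      rw [← h3]
      exact h2
    rw [intervalIntegral.integral_eq_sub_of_hasDerivAt hd
      (Continuous.intervalIntegrable (by fun_prop) _ _)]
    have h2 : 2 * α / 2 = α := by ring
    rw [h2, cos_pi_div_two, zero_pow (by omega)]
    ring
  · apply Continuous.integrableOn_Ioc
    fun_prop
  · filter_upwards [ae_restrict_mem measurableSet_Ioc] with y hy
    have h1 : 0 ≤ sin (y / 2) := sin_nonneg_of_nonneg_of_le_pi (by linarith [hy.1])
      (by linarith [hy.2, pi_pos])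
    have h2 : 0 ≤ cos (y / 2) := cos_nonneg_of_neg_pi_div_two_le_of_le (by linarith [hy.1, pi_pos])
      (by linarith [hy.2])
    show 0 ≤ 2 * sin (y / 2) * cos (y / 2) ^ (m - 1)
    positivity

theorem theta_calc (m : ℕ) (hm : 1 ≤ m) (r : ℝ) :
    ∫⁻ θ in Set.Ioo 0 π, ENNReal.ofReal (sin θ ^ (m - 1)) *
      (if √((1 + cos θ) / 2) ≤ r then
        ENNReal.ofReal ((√(2 - 2 * cos θ)) ^ ((3 : ℝ) - (m + 1 : ℕ))) else 0) =
      ENNReal.ofReal (4 / m) * ENNReal.ofReal ((min (max r 0) 1) ^ m) := by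
  set r' := min (max r 0) 1 with hr'
  have h0 : 0 ≤ r' := le_min (le_max_right _ _) zero_le_one
  have h1 : r' ≤ 1 := min_le_right _ _
  set α := arccos r' with hα
  have hα0 : 0 ≤ α := arccos_nonneg _
  have hα1 : α ≤ π / 2 := arccos_le_pi_div_two.mpr h0
  have hcos : cos α = r' := cos_arccos (by linarith) h1
  rw [← ENNReal.ofReal_mul (by positivity), ← hcos, ← trig_int m hm α hα0 hα1]
  have hset : Set.Ioo (2 * α) π = Set.Ioi (2 * α) ∩ Set.Ioo 0 π := by
    ext θ
    simp only [Set.mem_Ioo, Set.mem_inter_iff, Set.mem_Ioi]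
    constructor
    · rintro ⟨h, h'⟩; exact ⟨h, by linarith, h'⟩
    · rintro ⟨h, h', h''⟩; exact ⟨h, h''⟩
  rw [hset, ← setLIntegral_indicator measurableSet_Ioi]
  refine lintegral_congr_ae ?_
  filter_upwards [ae_restrict_mem measurableSet_Ioo,
    ae_restrict_of_ae (Measure.ae_ne volume (2 * α))] with θ hθ hne
  have hs : 0 < sin (θ / 2) := sin_pos_of_pos_of_lt_pi (by linarith [hθ.1])
    (by linarith [hθ.2, pi_pos])
  have hc : 0 < cos (θ / 2) := cos_pos_of_mem_Ioo ⟨by linarith [hθ.1, pi_pos],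
    by linarith [hθ.2]⟩
  have hc1 : cos (θ / 2) ≤ 1 := cos_le_one _
  have e1 : cos θ = 2 * cos (θ / 2) ^ 2 - 1 := by rw [← cos_two_mul]; congr 1; ring
  have e2 : sin θ = 2 * sin (θ / 2) * cos (θ / 2) := by rw [← sin_two_mul]; congr 1; ring
  have e3 : √((1 + cos θ) / 2) = cos (θ / 2) := by
    rw [e1, ← Real.sqrt_sq hc.le]; congr 1; rw [Real.sqrt_sq hc.le]; ring
  have e4 : √(2 - 2 * cos θ) = 2 * sin (θ / 2) := by
    rw [← Real.sqrt_sq (by positivity : 0 ≤ 2 * sin (θ / 2))]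
    congr 1
    rw [e1]
    nlinarith [sin_sq_add_cos_sq (θ / 2)]
  have hiff : cos (θ / 2) ≤ r ↔ θ ∈ Set.Ioi (2 * α) := by
    have a1 : cos (θ / 2) ≤ r ↔ cos (θ / 2) ≤ r' := by
      rw [hr', le_min_iff, le_max_iff]
      constructor
      · intro h; exact ⟨Or.inl h, hc1⟩
      · rintro ⟨h | h, -⟩
        · exact h
        · linarith
    rw [a1, ← hcos, strictAntiOn_cos.le_iff_ge ⟨by linarith [hθ.1], by linarith [hθ.2, pi_pos]⟩
      ⟨hα0, by linarith [pi_pos]⟩, Set.mem_Ioi]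
    constructor
    · intro h; exact lt_of_le_of_ne (by linarith) hne.symm
    · intro h; linarith
  rw [e3, e4]
  by_cases h : cos (θ / 2) ≤ r
  · rw [if_pos h, Set.indicator_of_mem (hiff.mp h), ← ENNReal.ofReal_mul
      (pow_nonneg (by rw [e2]; positivity) _)]
    congr 1
    have hp : (2 * sin (θ / 2)) ^ ((3 : ℝ) - (m + 1 : ℕ)) =
        2 * sin (θ / 2) / (2 * sin (θ / 2)) ^ (m - 1) := by
      have : (3 : ℝ) - (m + 1 : ℕ) = 1 - (m - 1 : ℕ) := by
        push_cast [Nat.cast_sub hm]; ring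
      rw [this, Real.rpow_sub (by positivity), Real.rpow_one, Real.rpow_natCast]
    rw [hp, e2, mul_pow]
    field_simp
  · rw [if_neg h, Set.indicator_of_notMem (fun h' => h (hiff.mpr h')), mul_zero]

/-- The (unnormalized) density. -/
def dens (n : ℕ) (p : En n × En n) : ℝ≥0∞ := ENNReal.ofReal (‖p.1 - p.2‖ ^ ((3 : ℝ) - n))

/-- The half-length of the sum: the distance of the chord from the origin. -/
def Tm (n : ℕ) (p : En n × En n) : ℝ := ‖p.1 + p.2‖ / 2

theorem dens_meas (n : ℕ) : Measurable (dens n) := by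
  unfold dens; fun_prop

theorem Tm_meas (n : ℕ) : Measurable (Tm n) := by
  unfold Tm; fun_prop

theorem inner_dens (m : ℕ) (hm : 1 ≤ m) : ∃ C : ℝ≥0∞, C ≠ 0 ∧ C ≠ ∞ ∧
    ∀ (r : ℝ) (x : En (m + 1)), ‖x‖ = 1 →
      ∫⁻ y, (if Tm (m + 1) (x, y) ≤ r then dens (m + 1) (x, y) else 0) ∂(sigmaN (m + 1)) =
        C * ENNReal.ofReal ((min (max r 0) 1) ^ m) := by
  obtain ⟨K, hK0, hK1, hK⟩ := marginal m hm
  refine ⟨K * ENNReal.ofReal (4 / m), ?_, ENNReal.mul_ne_top hK1 ENNReal.ofReal_ne_top, ?_⟩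
  · refine mul_ne_zero hK0 ?_
    rw [Ne, ENNReal.ofReal_eq_zero, not_le]
    positivity
  intro r x hx
  obtain ⟨g, rfl⟩ := transitive1 (e0 m) x (by rw [hx, e0_norm])
  rw [mul_assoc, ← theta_calc m hm r]
  let ψ : ℝ → ℝ≥0∞ := fun t => if √((1 + t) / 2) ≤ r then
        ENNReal.ofReal ((√(2 - 2 * t)) ^ ((3 : ℝ) - (m + 1 : ℕ))) else 0
  have hψ : Measurable ψ := by
    refine Measurable.ite (measurableSet_le (by fun_prop) measurable_const) ?_ measurable_const
    fun_prop
  have h1 := hK ψ hψ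
  rw [← h1]
  have hmeas : Measurable (fun y => if Tm (m + 1) (g (e0 m), y) ≤ r then
      dens (m + 1) (g (e0 m), y) else 0) := by
    refine Measurable.ite (measurableSet_le ?_ measurable_const) ?_ measurable_const
    · exact (Tm_meas _).comp (by fun_prop)
    · exact (dens_meas _).comp (by fun_prop)
  conv_lhs => rw [← sigma_map g]
  rw [lintegral_map hmeas g.continuous.measurable]
  refine lintegral_congr_ae ?_
  filter_upwards [sigma_ae m] with y hy
  have hT : Tm (m + 1) (g (e0 m), g y) = √((1 + ⟪e0 m, y⟫) / 2) := by
    simp only [Tm]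
    rw [← map_add, LinearIsometryEquiv.norm_map]
    rw [← Real.sqrt_sq (by positivity : 0 ≤ ‖e0 m + y‖ / 2), div_pow, norm_add_sq_real, e0_norm,
      hy]
    congr 1; ring
  have hD : ‖g (e0 m) - g y‖ = √(2 - 2 * ⟪e0 m, y⟫) := by
    rw [← map_sub, LinearIsometryEquiv.norm_map]
    rw [← Real.sqrt_sq (norm_nonneg _), norm_sub_sq_real, e0_norm, hy]
    congr 1; ring
  simp only [ψ, dens, hT, hD]


/-- Explicit form of the reflection exchanging `e0` and a unit vector `v`. -/
def rho (m : ℕ) (v z : En (m + 1)) : En (m + 1) :=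
  z - (2 * (⟪e0 m - v, z⟫ / ‖e0 m - v‖ ^ 2)) • (e0 m - v)

theorem rho_meas (m : ℕ) : Measurable (fun p : En (m + 1) × En (m + 1) => rho m p.1 p.2) := by
  unfold rho
  fun_prop

theorem rho_spec (m : ℕ) (v : En (m + 1)) (hv : ‖v‖ = 1) :
    ∃ g : En (m + 1) ≃ₗᵢ[ℝ] En (m + 1), g (e0 m) = v ∧ ∀ z, g z = rho m v z := by
  refine ⟨((Submodule.span ℝ {e0 m - v})ᗮ).reflection, ?_, fun z => ?_⟩
  · exact Submodule.reflection_sub (by rw [hv, e0_norm])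
  · rw [Submodule.reflection_orthogonal_apply, Submodule.reflection_singleton_apply]
    unfold rho
    simp only [RCLike.ofReal_real_eq_id, id, neg_sub, two_smul, two_mul, add_smul]

theorem lambda_eq_map (m : ℕ) (v : En (m + 1)) (hv : ‖v‖ = 1) :
    lambdaN (m + 1) v = (lambdaN (m + 1) (e0 m)).map (rho m v) := by
  obtain ⟨g, hg, hg2⟩ := rho_spec m v hv
  have : rho m v = g := funext fun z => (hg2 z).symm
  rw [this, lambda_map, hg]

theorem lambda_prob (m : ℕ) (v : En (m + 1)) (hv : ‖v‖ = 1) :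
    IsProbabilityMeasure (lambdaN (m + 1) v) := by
  rw [lambda_eq_map m v hv]
  exact Measure.isProbabilityMeasure_map ((rho_meas m).comp measurable_prodMk_left).aemeasurable

theorem kern_aemeas (m : ℕ) :
    AEMeasurable (fun v => (Measure.dirac v).prod (lambdaN (m + 1) v)) (sigmaN (m + 1)) := by
  have hm : Measurable (fun p : En (m + 1) × En (m + 1) => (p.1, rho m p.1 p.2)) :=
    measurable_fst.prodMk (rho_meas m)
  refine ⟨fun v => (lambdaN (m + 1) (e0 m)).map (fun z => (v, rho m v z)), ?_, ?_⟩
  · refine Measure.measurable_of_measurable_coe _ fun s hs => ?_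
    have h : ∀ v : En (m + 1), Measurable (fun z => (v, rho m v z)) := fun v =>
      hm.comp measurable_prodMk_left
    simp_rw [fun v => Measure.map_apply (μ := lambdaN (m + 1) (e0 m)) (h v) hs]
    exact measurable_measure_prodMk_left (hm hs)
  · filter_upwards [sigma_ae m] with v hv
    have := lambda_prob m v hv
    have h1 : Measurable (rho m v) := (rho_meas m).comp measurable_prodMk_left
    rw [Measure.dirac_prod, lambda_eq_map m v hv, Measure.map_map measurable_prodMk_left h1]
    rfl

theorem kin_apply (m : ℕ) (s : Set (En (m + 1) × En (m + 1))) (hs : MeasurableSet s) :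
    kinematic (m + 1) s = ∫⁻ v, lambdaN (m + 1) v {z | (v, z) ∈ s} ∂sigmaN (m + 1) := by
  unfold kinematic
  rw [Measure.bind_apply hs (kern_aemeas m)]
  refine lintegral_congr_ae ?_
  filter_upwards [sigma_ae m] with v hv
  have := lambda_prob m v hv
  rw [Measure.dirac_prod, Measure.map_apply measurable_prodMk_left hs]
  rfl

instance kin_prob (m : ℕ) : IsProbabilityMeasure (kinematic (m + 1)) := by
  constructor
  rw [kin_apply m _ MeasurableSet.univ]
  rw [lintegral_congr_ae (g := fun _ => 1)]
  · simp
  · filter_upwards [sigma_ae m] with v hv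
    have := lambda_prob m v hv
    simp

theorem kin_map (m : ℕ) (g : En (m + 1) ≃ₗᵢ[ℝ] En (m + 1)) :
    (kinematic (m + 1)).map (fun p => (g p.1, g p.2)) = kinematic (m + 1) := by
  have hg : Measurable g := g.continuous.measurable
  have hgg : Measurable (fun p : En (m + 1) × En (m + 1) => (g p.1, g p.2)) :=
    (hg.comp measurable_fst).prodMk (hg.comp measurable_snd)
  ext s hs
  rw [Measure.map_apply hgg hs, kin_apply m _ (hgg hs), kin_apply m _ hs]
  have h1 : MeasurePreserving g (sigmaN (m + 1)) (sigmaN (m + 1)) := ⟨hg, sigma_map g⟩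
  have h2 : MeasurableEmbedding g := g.toHomeomorph.measurableEmbedding
  rw [← h1.lintegral_comp_emb h2 (fun v => lambdaN (m + 1) v {z | (v, z) ∈ s})]
  refine lintegral_congr fun v => ?_
  have h3 : MeasurableSet {z | (g v, z) ∈ s} := measurable_prodMk_left hs
  rw [← lambda_map g v, Measure.map_apply hg h3]
  rfl

theorem kin_ae (m : ℕ) :
    ∀ᵐ p ∂kinematic (m + 1), ‖p.1‖ = 1 ∧ ⟪p.1, p.2⟫ = 0 ∧ ‖p.2‖ < 1 := by
  have hs : MeasurableSet {p : En (m + 1) × En (m + 1) |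
      ‖p.1‖ = 1 ∧ ⟪p.1, p.2⟫ = 0 ∧ ‖p.2‖ < 1} := by
    have a1 : MeasurableSet {p : En (m + 1) × En (m + 1) | ‖p.1‖ = 1} :=
      measurableSet_eq_fun (by fun_prop) (by fun_prop)
    have a2 : MeasurableSet {p : En (m + 1) × En (m + 1) | ⟪p.1, p.2⟫ = 0} :=
      measurableSet_eq_fun (by fun_prop) (by fun_prop)
    have a3 : MeasurableSet {p : En (m + 1) × En (m + 1) | ‖p.2‖ < 1} :=
      measurableSet_lt (by fun_prop) (by fun_prop)
    exact a1.inter (a2.inter a3)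
  rw [ae_iff]
  show kinematic (m + 1) {p : En (m + 1) × En (m + 1) |
      ‖p.1‖ = 1 ∧ ⟪p.1, p.2⟫ = 0 ∧ ‖p.2‖ < 1}ᶜ = 0
  rw [kin_apply m _ hs.compl, lintegral_congr_ae (g := fun _ => 0)]
  · simp
  · filter_upwards [sigma_ae m] with v hv
    have h1 : lambdaN (m + 1) v (disc (m + 1) v)ᶜ = 0 := by
      unfold lambdaN
      rw [Measure.smul_apply, Measure.restrict_apply (measurableSet_disc _ _).compl]
      simp
    refine measure_mono_null ?_ h1
    intro z hz hz2
    exact hz ⟨hv, hz2.1, hz2.2⟩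

theorem kin_norm (m : ℕ) (hm : 1 ≤ m) (r : ℝ) :
    kinematic (m + 1) {p | ‖p.2‖ ≤ r} = ENNReal.ofReal ((min (max r 0) 1) ^ m) := by
  have hs : MeasurableSet {p : En (m + 1) × En (m + 1) | ‖p.2‖ ≤ r} :=
    measurableSet_le (by fun_prop) (by fun_prop)
  rw [kin_apply m _ hs, lintegral_congr_ae (g := fun _ => ENNReal.ofReal ((min (max r 0) 1) ^ m))]
  · simp
  · filter_upwards [sigma_ae m] with v hv
    obtain ⟨g, hg, -⟩ := rho_spec m v hv
    have hgm : Measurable g := g.continuous.measurable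
    have h3 : MeasurableSet {z : En (m + 1) | ‖z‖ ≤ r} :=
      measurableSet_le (by fun_prop) (by fun_prop)
    rw [← hg, ← lambda_map]
    show (lambdaN (m + 1) (e0 m)).map g {z : En (m + 1) | ‖z‖ ≤ r} = _
    rw [Measure.map_apply hgm h3, ← lambda_norm m hm r]
    congr 1
    ext z
    simp

theorem X_meas (n : ℕ) : Measurable (Xpt n) := by unfold Xpt; fun_prop
theorem Y_meas (n : ℕ) : Measurable (Ypt n) := by unfold Ypt; fun_prop

theorem XY_norm (n : ℕ) (p : En n × En n) (h1 : ‖p.1‖ = 1) (h2 : ⟪p.1, p.2⟫ = 0) (h3 : ‖p.2‖ < 1) :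
    ‖Xpt n p‖ = 1 ∧ ‖Ypt n p‖ = 1 := by
  have h0 : 0 ≤ 1 - ‖p.2‖ ^ 2 := by nlinarith [norm_nonneg p.2]
  have hs := Real.sq_sqrt h0
  have h2' : ⟪p.2, p.1⟫ = 0 := by rw [real_inner_comm, h2]
  have key : ∀ x : En n, ‖x‖ ^ 2 = 1 → ‖x‖ = 1 := fun x hx => by
    nlinarith [norm_nonneg x]
  constructor
  · apply key
    unfold Xpt
    rw [norm_sub_sq_real, inner_smul_right, h2', norm_smul, h1, mul_one, Real.norm_eq_abs, sq_abs, hs]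
    ring
  · apply key
    unfold Ypt
    rw [norm_add_sq_real, inner_smul_right, h2', norm_smul, h1, mul_one, Real.norm_eq_abs, sq_abs, hs]
    ring

theorem Tm_XY (n : ℕ) (p : En n × En n) : Tm n (Xpt n p, Ypt n p) = ‖p.2‖ := by
  unfold Tm Xpt Ypt
  have : p.2 - √(1 - ‖p.2‖ ^ 2) • p.1 + (p.2 + √(1 - ‖p.2‖ ^ 2) • p.1) = (2 : ℝ) • p.2 := by
    rw [two_smul]; abel
  simp only [this, norm_smul]
  norm_num

/-- The joint law of entry and exit points. -/
def nu1 (n : ℕ) : Measure (En n × En n) := (kinematic n).map (fun p => (Xpt n p, Ypt n p))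

/-- The measure with density `‖x - y‖ ^ (3 - n)`. -/
def nu2 (n : ℕ) : Measure (En n × En n) := ((sigmaN n).prod (sigmaN n)).withDensity (dens n)

theorem XY_meas (n : ℕ) : Measurable (fun p : En n × En n => (Xpt n p, Ypt n p)) :=
  (X_meas n).prodMk (Y_meas n)

instance nu1_prob (m : ℕ) : IsProbabilityMeasure (nu1 (m + 1)) :=
  Measure.isProbabilityMeasure_map (XY_meas _).aemeasurable

theorem nu1_map (m : ℕ) (g : En (m + 1) ≃ₗᵢ[ℝ] En (m + 1)) :
    (nu1 (m + 1)).map (fun p => (g p.1, g p.2)) = nu1 (m + 1) := by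
  have hg : Measurable g := g.continuous.measurable
  have hgg : Measurable (fun p : En (m + 1) × En (m + 1) => (g p.1, g p.2)) :=
    (hg.comp measurable_fst).prodMk (hg.comp measurable_snd)
  unfold nu1
  rw [Measure.map_map hgg (XY_meas _)]
  conv_rhs => rw [← kin_map m g]
  rw [Measure.map_map (XY_meas _) hgg]
  congr 1
  funext p
  simp [Xpt, Ypt]

theorem nu2_map (m : ℕ) (g : En (m + 1) ≃ₗᵢ[ℝ] En (m + 1)) :
    (nu2 (m + 1)).map (fun p => (g p.1, g p.2)) = nu2 (m + 1) := by
  have hg : Measurable g := g.continuous.measurable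
  have hgg : Measurable (fun p : En (m + 1) × En (m + 1) => (g p.1, g p.2)) :=
    (hg.comp measurable_fst).prodMk (hg.comp measurable_snd)
  have hp : ((sigmaN (m + 1)).prod (sigmaN (m + 1))).map (fun p => (g p.1, g p.2)) =
      (sigmaN (m + 1)).prod (sigmaN (m + 1)) := by
    have := Measure.map_prod_map (sigmaN (m + 1)) (sigmaN (m + 1)) hg hg
    rw [sigma_map] at this
    exact this.symm
  ext s hs
  unfold nu2
  rw [Measure.map_apply hgg hs, withDensity_apply _ (hgg hs), withDensity_apply _ hs]
  conv_rhs => rw [← hp]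
  rw [setLIntegral_map hs (dens_meas _) hgg]
  refine lintegral_congr fun p => ?_
  simp only [dens]
  rw [← map_sub, g.norm_map]

theorem nu1_ae (m : ℕ) : ∀ᵐ p ∂nu1 (m + 1), ‖p.1‖ = 1 ∧ ‖p.2‖ = 1 := by
  have hs : MeasurableSet {p : En (m + 1) × En (m + 1) | ‖p.1‖ = 1 ∧ ‖p.2‖ = 1} :=
    MeasurableSet.inter (measurableSet_eq_fun (by fun_prop) (by fun_prop))
      (measurableSet_eq_fun (by fun_prop) (by fun_prop))
  unfold nu1
  rw [ae_map_iff (XY_meas _).aemeasurable hs]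
  filter_upwards [kin_ae m] with p hp
  exact XY_norm _ p hp.1 hp.2.1 hp.2.2

theorem nu2_ae (m : ℕ) : ∀ᵐ p ∂nu2 (m + 1), ‖p.1‖ = 1 ∧ ‖p.2‖ = 1 := by
  refine (withDensity_absolutelyContinuous _ _).ae_le ?_
  filter_upwards [Measure.quasiMeasurePreserving_fst.ae (sigma_ae m),
    Measure.quasiMeasurePreserving_snd.ae (sigma_ae m)] with p h1 h2 using ⟨h1, h2⟩

theorem nu2_T (m : ℕ) (C : ℝ≥0∞) (hC : ∀ (r : ℝ) (x : En (m + 1)), ‖x‖ = 1 →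
      ∫⁻ y, (if Tm (m + 1) (x, y) ≤ r then dens (m + 1) (x, y) else 0) ∂sigmaN (m + 1) =
        C * ENNReal.ofReal ((min (max r 0) 1) ^ m)) (r : ℝ) :
    (nu2 (m + 1)).map (Tm (m + 1)) (Set.Iic r) = C * ENNReal.ofReal ((min (max r 0) 1) ^ m) := by
  have hs : MeasurableSet (Tm (m + 1) ⁻¹' Set.Iic r) := Tm_meas _ measurableSet_Iic
  rw [Measure.map_apply (Tm_meas _) measurableSet_Iic]
  unfold nu2
  rw [withDensity_apply _ hs, ← lintegral_indicator hs,
    lintegral_prod _ ((dens_meas _).indicator hs).aemeasurable,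
    lintegral_congr_ae (g := fun _ => C * ENNReal.ofReal ((min (max r 0) 1) ^ m))]
  · simp
  · filter_upwards [sigma_ae m] with x hx
    rw [← hC r x hx]
    rfl

theorem nu1_T (m : ℕ) (hm : 1 ≤ m) (r : ℝ) :
    (nu1 (m + 1)).map (Tm (m + 1)) (Set.Iic r) = ENNReal.ofReal ((min (max r 0) 1) ^ m) := by
  unfold nu1
  rw [Measure.map_map (Tm_meas _) (XY_meas _),
    Measure.map_apply ((Tm_meas _).comp (XY_meas _)) measurableSet_Iic, ← kin_norm m hm r]
  congr 1
  ext p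
  simp [Tm_XY]

/-- A section of the orbit map. -/
def sect (m : ℕ) (f : En m) (r : ℝ) : En (m + 1) × En (m + 1) :=
  (e0 m, Jm m (2 * r ^ 2 - 1, √(1 - (2 * r ^ 2 - 1) ^ 2) • f))

theorem sect_meas (m : ℕ) (f : En m) : Measurable (sect m f) := by
  unfold sect
  refine measurable_const.prodMk ((Jm_meas m).comp ?_)
  fun_prop

theorem sect_orbit (m : ℕ) (f : En m) (hf : ‖f‖ = 1) (p : En (m + 1) × En (m + 1))
    (h1 : ‖p.1‖ = 1) (h2 : ‖p.2‖ = 1) : ∃ g : On (m + 1), p = g • sect m f (Tm (m + 1) p) := by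
  have hin : ⟪p.1, p.2⟫ = 2 * (Tm (m + 1) p) ^ 2 - 1 := by
    have := norm_add_sq_real p.1 p.2
    rw [h1, h2] at this
    unfold Tm
    rw [div_pow, this]
    ring
  have habs := abs_real_inner_le_norm p.1 p.2
  rw [h1, h2, hin, one_mul, abs_le] at habs
  set c := 2 * (Tm (m + 1) p) ^ 2 - 1 with hc
  have hc0 : 0 ≤ 1 - c ^ 2 := by nlinarith [habs.1, habs.2]
  have hn : ‖Jm m (c, √(1 - c ^ 2) • f)‖ = 1 := by
    have h := Jm_norm_sq m (c, √(1 - c ^ 2) • f)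
    simp only [norm_smul, hf, mul_one, Real.norm_eq_abs, sq_abs, Real.sq_sqrt hc0] at h
    nlinarith [norm_nonneg (Jm m (c, √(1 - c ^ 2) • f))]
  obtain ⟨g, hg1, hg2⟩ := transitive2 (e0 m) (Jm m (c, √(1 - c ^ 2) • f)) p.1 p.2
    (by rw [e0_norm, h1]) (by rw [hn, h2]) (by rw [e0_inner, hin])
  refine ⟨Unitary.linearIsometryEquiv.symm g, ?_⟩
  ext1
  · show p.1 = Unitary.linearIsometryEquiv.symm g • (e0 m)
    rw [On_smul_def, MulEquiv.apply_symm_apply, hg1]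
  · show p.2 = Unitary.linearIsometryEquiv.symm g • (Jm m (c, √(1 - c ^ 2) • f))
    rw [On_smul_def, MulEquiv.apply_symm_apply, hg2]

theorem nu_eq (m : ℕ) (hm : 1 ≤ m) : ∃ C : ℝ≥0∞, C ≠ 0 ∧ C ≠ ∞ ∧ C • nu1 (m + 1) = nu2 (m + 1) := by
  obtain ⟨C, hC0, hC1, hC⟩ := inner_dens m hm
  refine ⟨C, hC0, hC1, ?_⟩
  obtain ⟨η, i1, i2⟩ := exists_haar (m + 1)
  have hf : ‖(EuclideanSpace.single ⟨0, hm⟩ (1 : ℝ) : En m)‖ = 1 := by simp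
  have s2 : SFinite (nu2 (m + 1)) := by unfold nu2; infer_instance
  refine invariant_measure_ext (On_act_meas2 (m + 1)) η _ _ (fun g => ?_)
    (fun g => nu2_map m (Unitary.linearIsometryEquiv g)) (Tm (m + 1)) (Tm_meas _)
    (sect m (EuclideanSpace.single ⟨0, hm⟩ (1 : ℝ))) (sect_meas _ _) ?_ ?_ ?_
  · rw [Measure.map_smul]
    congr 1
    exact nu1_map m (Unitary.linearIsometryEquiv g)
  · refine Measure.ae_smul_measure ?_ C
    filter_upwards [nu1_ae m] with p hp using sect_orbit m _ hf p hp.1 hp.2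
  · filter_upwards [nu2_ae m] with p hp using sect_orbit m _ hf p hp.1 hp.2
  · have : IsFiniteMeasure (C • nu1 (m + 1)) := by
      constructor
      simp [hC1.lt_top]
    refine Measure.ext_of_Iic _ _ fun r => ?_
    rw [nu2_T m C hC, Measure.map_smul, Measure.smul_apply, nu1_T m hm, smul_eq_mul]

theorem nu2_prod (m : ℕ) (A B : Set (En (m + 1))) (hA : MeasurableSet A) (hB : MeasurableSet B) :
    nu2 (m + 1) (A ×ˢ B) = ∫⁻ x in A, ∫⁻ y in B,
      ENNReal.ofReal (‖x - y‖ ^ ((3 : ℝ) - (m + 1 : ℕ))) ∂(sigmaN (m + 1)) ∂(sigmaN (m + 1)) := by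
  unfold nu2
  rw [withDensity_apply _ (hA.prod hB), ← Measure.prod_restrict,
    lintegral_prod _ (dens_meas _).aemeasurable]
  rfl

/-- The joint distribution of the entry and exit points of a random line meeting
`S^{n-1}` has density proportional to `‖x-y‖^{3-n}` with respect to `σ ⊗ σ`. -/
theorem joint_density_entry_exit (n : ℕ) (hn : 2 ≤ n)
    (A B : Set (En n)) (hA : MeasurableSet A) (hB : MeasurableSet B)
    (hAS : A ⊆ unitSphere n) (hBS : B ⊆ unitSphere n) :
    kinematic n {p : En n × En n | Xpt n p ∈ A ∧ Ypt n p ∈ B} =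
      (∫⁻ x, ∫⁻ y, ENNReal.ofReal (‖x - y‖ ^ ((3 : ℝ) - n)) ∂(sigmaN n) ∂(sigmaN n))⁻¹ *
        ∫⁻ x in A, ∫⁻ y in B, ENNReal.ofReal (‖x - y‖ ^ ((3 : ℝ) - n))
          ∂(sigmaN n) ∂(sigmaN n) := by
  obtain ⟨m, rfl⟩ : ∃ m, n = m + 1 := ⟨n - 1, by omega⟩
  obtain ⟨C, hC0, hC1, hC⟩ := nu_eq m (by omega)
  have hU := nu2_prod m Set.univ Set.univ MeasurableSet.univ MeasurableSet.univ
  rw [Measure.restrict_univ, Set.univ_prod_univ, ← hC, Measure.smul_apply, measure_univ,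
    smul_eq_mul, mul_one] at hU
  have hAB := nu2_prod m A B hA hB
  rw [← hU, ← hAB, ← hC, Measure.smul_apply, smul_eq_mul, ← mul_assoc,
    ENNReal.inv_mul_cancel hC0 hC1, one_mul]
  unfold nu1
  rw [Measure.map_apply (XY_meas _) (hA.prod hB)]
  rfl

end
end

section
/- Let φ : ℝ² → ℝ be twice continuously differentiable with φ(0) = 0 and ∇φ(0) = 0, and let Q denote the Hessian of φ at 0 (a symmetric bilinear form/matrix). Then for every unit vector w ∈ ℝ², the quadratic Crofton integrand of the graph of φ between the origin and the point (εw, φ(εw)) satisfies: lim_{ε → 0⁺} |φ(εw)| · |⟨∇φ(εw), εw⟩ − φ(εw)| / ( (ε² + φ(εw)²)² · √(1 + ‖∇φ(εw)‖²) ) = ⟨Qw, w⟩² / 4. -/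
open MeasureTheory Metric Real Filter
open scoped ENNReal RealInnerProductSpace Topology

noncomputable section

/-- Asymptotics of the quadratic Crofton integrand on the graph of a `C²` function:
if `φ(0) = 0` and `∇φ(0) = 0`, then for every unit vector `w` the integrand between the
origin and `(εw, φ(εw))` tends to `⟨Qw, w⟩²/4` as `ε → 0⁺`, where `Q` is the Hessian of
`φ` at `0`. -/
theorem crofton_integrand_graph_limit (φ : En 2 → ℝ) (hφ : ContDiff ℝ 2 φ)
    (hφ0 : φ 0 = 0) (hgrad0 : gradient φ 0 = 0) (w : En 2) (hw : ‖w‖ = 1) :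
    Filter.Tendsto
      (fun ε : ℝ =>
        |φ (ε • w)| * |⟪gradient φ (ε • w), ε • w⟫ - φ (ε • w)| /
          ((ε ^ 2 + φ (ε • w) ^ 2) ^ 2 * Real.sqrt (1 + ‖gradient φ (ε • w)‖ ^ 2)))
      (nhdsWithin 0 (Set.Ioi 0))
      (nhds ((iteratedFDeriv ℝ 2 φ 0 ![w, w]) ^ 2 / 4)) := by
  have hd : Differentiable ℝ φ := hφ.differentiable (by norm_num)
  have hgi : ∀ x v : En 2, ⟪gradient φ x, v⟫ = fderiv ℝ φ x v := by
    intro x v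
    simp [gradient]
  have hf0 : fderiv ℝ φ 0 = 0 := by
    ext v
    rw [← hgi, hgrad0]
    simp
  have hline : ∀ t : ℝ, HasDerivAt (fun t : ℝ => t • w) w t := by
    intro t
    simpa using (hasDerivAt_id t).smul_const w
  have hg : ∀ t : ℝ, HasDerivAt (fun t : ℝ => φ (t • w)) (fderiv ℝ φ (t • w) w) t := by
    intro t
    exact (hd (t • w)).hasFDerivAt.comp_hasDerivAt t (hline t)
  have hfd : ContDiff ℝ 1 (fderiv ℝ φ) := hφ.fderiv_right (by norm_num)
  have hdd : Differentiable ℝ (fderiv ℝ φ) := hfd.differentiable (by norm_num)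
  set q : ℝ := iteratedFDeriv ℝ 2 φ 0 ![w, w] with hqdef
  have hq : q = fderiv ℝ (fderiv ℝ φ) 0 w w := by
    rw [hqdef, iteratedFDeriv_two_apply]
    simp
  have hg2 : HasDerivAt (fun t : ℝ => fderiv ℝ φ (t • w) w) q 0 := by
    have h1 : HasFDerivAt (fderiv ℝ φ) (fderiv ℝ (fderiv ℝ φ) ((0:ℝ) • w)) ((0:ℝ) • w) :=
      (hdd _).hasFDerivAt
    have h2 := h1.comp_hasDerivAt (0:ℝ) (hline 0)
    have h3 := h2.clm_apply (hasDerivAt_const (0:ℝ) w)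
    rw [hq]
    simpa using h3
  have hB : Tendsto (fun t : ℝ => fderiv ℝ φ (t • w) w / t) (𝓝[>] 0) (𝓝 q) := by
    have h := hg2.tendsto_slope_zero_right
    refine h.congr (fun t => ?_)
    simp [hf0, div_eq_inv_mul]
  have hA : Tendsto (fun t : ℝ => φ (t • w) / t ^ 2) (𝓝[>] 0) (𝓝 (q / 2)) := by
    refine HasDerivAt.lhopital_zero_nhdsGT (f' := fun t => fderiv ℝ φ (t • w) w)
      (g' := fun t => 2 * t) ?_ ?_ ?_ ?_ ?_ ?_
    · exact Eventually.of_forall hg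
    · refine Eventually.of_forall (fun t => ?_)
      simpa using hasDerivAt_pow 2 t
    · filter_upwards [self_mem_nhdsWithin] with t ht
      have : (0:ℝ) < t := ht
      positivity
    · have h := (hg 0).continuousAt.tendsto
      simp only [zero_smul, hφ0] at h
      exact h.mono_left nhdsWithin_le_nhds
    · have h : Tendsto (fun t : ℝ => t ^ 2) (𝓝 0) (𝓝 ((0:ℝ) ^ 2)) :=
        (continuous_pow 2).tendsto 0
      simp only [ne_eq, OfNat.ofNat_ne_zero, not_false_eq_true, zero_pow] at h
      exact h.mono_left nhdsWithin_le_nhds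
    · refine (hB.div_const 2).congr (fun t => ?_)
      rw [div_div, mul_comm]
  have hT : Tendsto (fun t : ℝ => t) (𝓝[>] 0) (𝓝 (0:ℝ)) := nhdsWithin_le_nhds
  have hN : Tendsto (fun t : ℝ => ‖gradient φ (t • w)‖) (𝓝[>] 0) (𝓝 0) := by
    have hc : Continuous (fun t : ℝ => ‖fderiv ℝ φ (t • w)‖) := by
      have := hfd.continuous
      fun_prop
    have h := hc.tendsto 0
    simp only [zero_smul, hf0, norm_zero] at h
    refine (h.mono_left nhdsWithin_le_nhds).congr (fun t => ?_)
    simp [gradient]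
  have hS : Tendsto (fun t : ℝ => Real.sqrt (1 + ‖gradient φ (t • w)‖ ^ 2)) (𝓝[>] 0) (𝓝 1) := by
    have h := ((hN.pow 2).const_add 1).sqrt
    simpa using h
  have hD : Tendsto (fun t : ℝ => (1 + (t * (φ (t • w) / t ^ 2)) ^ 2) ^ 2) (𝓝[>] 0) (𝓝 1) := by
    have h := (((hT.mul hA).pow 2).const_add 1).pow 2
    simpa using h
  have hfin := (hA.abs.mul (hB.sub hA).abs).div (hD.mul hS) (by norm_num)
  have hval : |q / 2| * |q - q / 2| / (1 * 1) = q ^ 2 / 4 := by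
    rw [sub_half, abs_mul_abs_self]
    ring
  rw [hval] at hfin
  refine hfin.congr' ?_
  filter_upwards [self_mem_nhdsWithin] with t ht
  have ht : (0:ℝ) < t := ht
  simp only [Pi.div_apply, hgi, map_smul, smul_eq_mul]
  have e1 : fderiv ℝ φ (t • w) w / t - φ (t • w) / t ^ 2
      = (t * fderiv ℝ φ (t • w) w - φ (t • w)) / t ^ 2 := by
    field_simp
  have e2 : 1 + (t * (φ (t • w) / t ^ 2)) ^ 2 = (t ^ 2 + φ (t • w) ^ 2) / t ^ 2 := by
    field_simp
  have hs : 0 < Real.sqrt (1 + ‖gradient φ (t • w)‖ ^ 2) := by positivity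
  have hp : 0 < t ^ 2 + φ (t • w) ^ 2 := by positivity
  rw [e1, e2, abs_div, abs_div, abs_of_pos (by positivity : (0:ℝ) < t ^ 2)]
  field_simp

end
end
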